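/- arXiv:2007.09443 — 3 statements merged into one kernel-verified Lean document; each statement's English description precedes it below -/
import Mathlib

section
/- If Δ is a pure, balanced simplicial complex on X having at least one facet, then there exists a simplicial complex Δ' on X, all of whose facets are irrelevant faces, such that Δ ∪ Δ' is shellable. -/
noncomputable section

/-- The vertex set `X` of `P^{n_1} × ⋯ × P^{n_r}`: pairs `(i, j)` with `i ∈ Fin r`,
`j ∈ Fin (n i + 1)` (so `0 ≤ j ≤ n_i`). -/
abbrev Vtx (r : ℕ) (n : Fin r → ℕ) : Type := (i : Fin r) × Fin (n i + 1)

/-- A simplicial complex: a collection of finite subsets closed under taking subsets. -/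
def IsComplex {α : Type} (Δ : Finset α → Prop) : Prop :=
  ∀ σ τ : Finset α, τ ⊆ σ → Δ σ → Δ τ

/-- A facet is a maximal face. -/
def IsFacet {α : Type} (Δ : Finset α → Prop) (F : Finset α) : Prop :=
  Δ F ∧ ∀ G : Finset α, Δ G → F ⊆ G → F = G

/-- A complex is pure if all facets have equal cardinality. -/
def IsPure {α : Type} (Δ : Finset α → Prop) : Prop :=
  ∀ F G : Finset α, IsFacet Δ F → IsFacet Δ G → F.card = G.card

/-- A face is relevant if it contains at least one vertex from every component. -/
def Relevant {r : ℕ} {n : Fin r → ℕ} (σ : Finset (Vtx r n)) : Prop :=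
  ∀ i : Fin r, ∃ v ∈ σ, v.1 = i

/-- A set of vertices is balanced if it contains exactly one vertex from each component. -/
def BalancedFace {r : ℕ} {n : Fin r → ℕ} (σ : Finset (Vtx r n)) : Prop :=
  ∀ i : Fin r, ∃! j : Fin (n i + 1), (⟨i, j⟩ : Vtx r n) ∈ σ

/-- A facet of the irrelevant complex: an `r`-element subset of `X` containing
exactly one pair of distinct vertices lying in the same component. -/
def IsIrrFacet {r : ℕ} {n : Fin r → ℕ} (τ : Finset (Vtx r n)) : Prop :=
  τ.card = r ∧
    ∃ v w : Vtx r n, v ∈ τ ∧ w ∈ τ ∧ v ≠ w ∧ v.1 = w.1 ∧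
      ∀ a b : Vtx r n, a ∈ τ → b ∈ τ → a ≠ b → a.1 = b.1 →
        (a = v ∧ b = w) ∨ (a = w ∧ b = v)

/-- The irrelevant complex `Δ_irr(n)`: faces are the subsets of the facets above. -/
def irrComplex (r : ℕ) (n : Fin r → ℕ) : Finset (Vtx r n) → Prop :=
  fun σ => ∃ τ : Finset (Vtx r n), σ ⊆ τ ∧ IsIrrFacet τ

/-- `F : Fin m → Finset α` is a shelling of `Δ`: an ordering `F 0, …, F (m-1)` of all
facets of `Δ` such that for each `i > 0` the subcomplex of faces of `F i` contained in
some earlier facet is pure of dimension `(F i).card - 2` (i.e. of codimension 1). -/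
def IsShelling {α : Type} (Δ : Finset α → Prop) {m : ℕ} (F : Fin m → Finset α) : Prop :=
  Function.Injective F ∧ (∀ i, IsFacet Δ (F i)) ∧ (∀ G, IsFacet Δ G → ∃ i, F i = G) ∧
    ∀ i : Fin m, 0 < (i : ℕ) → ∀ σ : Finset α, σ ⊆ F i → (∃ k, k < i ∧ σ ⊆ F k) →
      ∃ τ : Finset α, σ ⊆ τ ∧ τ ⊆ F i ∧ τ.card + 1 = (F i).card ∧ ∃ k, k < i ∧ τ ⊆ F k

/-- A complex is shellable if it is pure and admits a shelling. -/
def Shellable {α : Type} (Δ : Finset α → Prop) : Prop :=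
  IsPure Δ ∧ ∃ (m : ℕ) (F : Fin m → Finset α), IsShelling Δ F

/-- A pure complex is gallery-connected if any two facets are joined by a sequence of
facets in which consecutive facets meet in codimension 1. -/
def GalleryConnected {α : Type} [DecidableEq α] (Δ : Finset α → Prop) : Prop :=
  ∀ F F' : Finset α, IsFacet Δ F → IsFacet Δ F' →
    ∃ (m : ℕ) (g : ℕ → Finset α), g 0 = F ∧ g m = F' ∧ (∀ i ≤ m, IsFacet Δ (g i)) ∧
      ∀ i < m, (g i ∩ g (i + 1)).card + 1 = (g i).card


/-- An ordering of the facets by a key `κ` is a shelling as soon as, for distinct facets `G`, `H`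
with `κ H ≤ κ G`, some vertex of `G` outside `H` can be deleted so that the remaining ridge lies in
a facet of strictly smaller key. -/
theorem exists_isShelling_of_key {α β : Type} [Fintype α] [DecidableEq α] [LinearOrder β]
    (Δ : Finset α → Prop) (κ : Finset α → β)
    (h : ∀ G H, IsFacet Δ G → IsFacet Δ H → G ≠ H → κ H ≤ κ G →
      ∃ c ∈ G, c ∉ H ∧ ∃ K, IsFacet Δ K ∧ κ K < κ G ∧ G.erase c ⊆ K) :
    ∃ (m : ℕ) (F : Fin m → Finset α), IsShelling Δ F := by
  classical
  let e := (Fintype.equivFin {G : Finset α // IsFacet Δ G}).symm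
  let s := Tuple.sort fun i => κ (e i).1
  have hmono : Monotone fun i => κ (e (s i)).1 := Tuple.monotone_sort fun i => κ (e i).1
  have hinj : Function.Injective fun i => (e (s i)).1 :=
    Subtype.val_injective.comp (e.injective.comp s.injective)
  have hsurj : ∀ G, IsFacet Δ G → ∃ i, (e (s i)).1 = G := fun G hG =>
    ⟨s.symm (e.symm ⟨G, hG⟩), by simp⟩
  refine ⟨_, fun i => (e (s i)).1, hinj, fun i => (e (s i)).2, hsurj, ?_⟩
  rintro i - σ hσ ⟨k, hk, hσk⟩
  obtain ⟨c, hcG, hcH, K, hK, hlt, hsub⟩ := h _ _ (e (s i)).2 (e (s k)).2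
    (fun heq => hk.ne' (hinj heq)) (hmono hk.le)
  obtain ⟨j, rfl⟩ := hsurj K hK
  refine ⟨(e (s i)).1.erase c, ?_, Finset.erase_subset _ _, Finset.card_erase_add_one hcG, j, ?_,
    hsub⟩
  · exact Finset.subset_erase.2 ⟨hσ, fun hc => hcH (hσk hc)⟩
  · exact lt_of_not_ge fun hle => absurd hlt (not_lt_of_ge (hmono hle))

/-- In a finite vertex set every face lies in a facet. -/
theorem exists_isFacet_superset {α : Type} [Fintype α] {Δ : Finset α → Prop} {σ : Finset α}
    (hσ : Δ σ) : ∃ F, IsFacet Δ F ∧ σ ⊆ F := by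
  obtain ⟨F, hle, hF⟩ := (Set.toFinite {τ | Δ τ}).exists_le_maximal hσ
  exact ⟨F, ⟨hF.prop, fun G hG hFG => hF.eq_of_le hG hFG⟩, hle⟩

section

variable {r : ℕ} {n : Fin r → ℕ}

theorem BalancedFace.relevant {F : Finset (Vtx r n)} (hF : BalancedFace F) : Relevant F := by
  intro i
  obtain ⟨j, hj, -⟩ := hF i
  exact ⟨_, hj, rfl⟩

theorem BalancedFace.injOn {F : Finset (Vtx r n)} (hF : BalancedFace F) :
    Set.InjOn Sigma.fst (F : Set (Vtx r n)) := by
  rintro ⟨i, a⟩ ha ⟨j, b⟩ hb hij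
  obtain rfl : i = j := hij
  rw [(hF i).unique ha hb]

theorem Relevant.image_fst {F : Finset (Vtx r n)} (hF : Relevant F) :
    F.image Sigma.fst = Finset.univ := by
  ext i
  simpa using hF i

theorem BalancedFace.card_eq {F : Finset (Vtx r n)} (hF : BalancedFace F) : F.card = r := by
  rw [← Finset.card_image_of_injOn hF.injOn, hF.relevant.image_fst, Finset.card_univ,
    Fintype.card_fin]

theorem Relevant.injOn_of_card_eq {F : Finset (Vtx r n)} (hF : Relevant F) (hc : F.card = r) :
    Set.InjOn Sigma.fst (F : Set (Vtx r n)) := by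
  rw [← Finset.card_image_iff, hF.image_fst, hc, Finset.card_univ, Fintype.card_fin]

/-- The cost of a vertex relative to a set `T`: the vertices whose component meets `T` are
cheaper than all the others. -/
def vertexCost (T : Finset (Vtx r n)) (v : Vtx r n) : ℕ :=
  if v.1 ∈ T.image Sigma.fst then v.1 else r + v.1

theorem fst_eq_of_vertexCost_eq {T : Finset (Vtx r n)} {v w : Vtx r n}
    (h : vertexCost T v = vertexCost T w) : v.1 = w.1 := by
  have hv := v.1.isLt
  have hw := w.1.isLt
  unfold vertexCost at h
  apply Fin.ext
  split_ifs at h <;> omega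

theorem vertexCost_lt_of_mem {T : Finset (Vtx r n)} {v w : Vtx r n}
    (hv : v.1 ∈ T.image Sigma.fst) (hw : w.1 ∉ T.image Sigma.fst) :
    vertexCost T v < vertexCost T w := by
  have := v.1.isLt
  unfold vertexCost
  rw [if_pos hv, if_neg hw]
  omega

/-- The key by which facets are ordered, relative to a fixed facet `Z`. -/
def facetKey (Z G : Finset (Vtx r n)) : ℕ ×ₗ ℕ :=
  toLex ((G \ Z).card, ∑ v ∈ G, vertexCost (G \ Z) v)

/-- A vertex outside `Z` can be traded for a vertex of `Z` within the irrelevant sets, unless it is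
the only vertex outside `Z`. -/
theorem exists_exchange_or_erase_subset {Z G : Finset (Vtx r n)} (hZ : BalancedFace Z)
    (hG : G.card = r) {c : Vtx r n} (hc : c ∈ G) (hcZ : c ∉ Z) :
    (∃ z ∈ Z, z ∉ G ∧ ¬ Relevant (insert z (G.erase c))) ∨ G.erase c ⊆ Z := by
  refine or_iff_not_imp_left.2 fun hno => ?_
  push Not at hno
  have hcard : ∀ z ∉ G, (insert z (G.erase c)).card = r := fun z hz => by
    rw [Finset.card_insert_of_notMem (fun h => hz (Finset.mem_of_mem_erase h)),
      Finset.card_erase_add_one hc, hG]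
  have hone : (Z \ G).card ≤ 1 := by
    rw [Finset.card_le_one]
    intro z hz w hw
    rw [Finset.mem_sdiff] at hz hw
    by_contra hzw
    have hfst : w.1 ≠ z.1 := fun h => hzw (hZ.injOn hw.1 hz.1 h).symm
    obtain ⟨k, hk, hkw⟩ := hno z hz.1 hz.2 w.1
    rcases Finset.mem_insert.1 hk with rfl | hk
    · exact hfst hkw.symm
    · have := (hno w hw.1 hw.2).injOn_of_card_eq (hcard w hw.2)
        (Finset.mem_insert_of_mem hk) (Finset.mem_insert_self _ _) hkw
      exact hw.2 (this ▸ Finset.mem_of_mem_erase hk)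
  rw [Finset.card_sdiff_comm (hZ.card_eq.trans hG.symm), Finset.card_le_one] at hone
  intro v hv
  rw [Finset.mem_erase] at hv
  by_contra hvZ
  exact hv.1 (hone _ (Finset.mem_sdiff.2 ⟨hv.2, hvZ⟩) _ (Finset.mem_sdiff.2 ⟨hc, hcZ⟩))

/-- Trading a vertex of `Z` for a cheaper vertex of `Z` never produces a relevant set. -/
theorem not_relevant_exchange {Z G : Finset (Vtx r n)} (hZ : BalancedFace Z)
    (hG : G.card = r) {b c : Vtx r n} (hc : c ∈ G) (hcZ : c ∈ Z) (hb : b ∉ G) (hbZ : b ∈ Z)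
    (hlt : vertexCost (G \ Z) b < vertexCost (G \ Z) c) :
    ¬ Relevant (insert b (G.erase c)) := by
  intro hK
  have hinj := hK.injOn_of_card_eq (by
    rw [Finset.card_insert_of_notMem (fun h => hb (Finset.mem_of_mem_erase h)),
      Finset.card_erase_add_one hc, hG])
  have hmem : ∀ t ∈ G, t ∉ Z → t ∈ insert b (G.erase c) := fun t ht htZ =>
    Finset.mem_insert_of_mem (Finset.mem_erase.2 ⟨fun h => htZ (h ▸ hcZ), ht⟩)
  have hbT : b.1 ∉ (G \ Z).image Sigma.fst := by
    intro h
    obtain ⟨t, ht, htb⟩ := Finset.mem_image.1 h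
    rw [Finset.mem_sdiff] at ht
    exact hb (hinj (hmem t ht.1 ht.2) (Finset.mem_insert_self _ _) htb ▸ ht.1)
  have hcT : c.1 ∈ (G \ Z).image Sigma.fst := by
    obtain ⟨k, hk, hkc⟩ := hK c.1
    have hkne : k ≠ c := by
      rintro rfl
      rcases Finset.mem_insert.1 hk with rfl | h
      · exact hb hc
      · exact Finset.notMem_erase _ _ h
    have hkZ : k ∉ Z := fun h => hkne (hZ.injOn h hcZ hkc)
    rcases Finset.mem_insert.1 hk with rfl | h
    · exact absurd hbZ hkZ
    · exact Finset.mem_image.2 ⟨k, Finset.mem_sdiff.2 ⟨Finset.mem_of_mem_erase h, hkZ⟩, hkc⟩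
  exact absurd hlt (not_lt_of_gt (vertexCost_lt_of_mem hcT hbT))

theorem facetKey_exchange_lt_of_notMem {Z G : Finset (Vtx r n)} {z c : Vtx r n} (hc : c ∈ G)
    (hcZ : c ∉ Z) (hzZ : z ∈ Z) : facetKey Z (insert z (G.erase c)) < facetKey Z G := by
  refine Prod.Lex.toLex_lt_toLex.2 (Or.inl (Finset.card_lt_card ?_))
  rw [Finset.insert_sdiff_of_mem _ hzZ, Finset.erase_sdiff_comm]
  exact Finset.erase_ssubset (Finset.mem_sdiff.2 ⟨hc, hcZ⟩)

theorem facetKey_exchange_lt_of_mem {Z G : Finset (Vtx r n)} {b c : Vtx r n} (hc : c ∈ G)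
    (hcZ : c ∈ Z) (hb : b ∉ G) (hbZ : b ∈ Z)
    (hlt : vertexCost (G \ Z) b < vertexCost (G \ Z) c) :
    facetKey Z (insert b (G.erase c)) < facetKey Z G := by
  have hsd : insert b (G.erase c) \ Z = G \ Z := by
    rw [Finset.insert_sdiff_of_mem _ hbZ, Finset.erase_sdiff_comm,
      Finset.erase_eq_of_notMem (fun h => (Finset.mem_sdiff.1 h).2 hcZ)]
  refine Prod.Lex.toLex_lt_toLex.2 (Or.inr ⟨by simp only [hsd], ?_⟩)
  simp only [hsd]
  rw [Finset.sum_insert (fun h => hb (Finset.mem_of_mem_erase h)), ← Finset.add_sum_erase G _ hc]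
  omega

/-- Between distinct sets of equal size, a set of no larger total weight has an element outside the
other one that is no heavier than some element it misses. -/
theorem exists_weight_le_of_sum_le {α : Type} [DecidableEq α] {G H : Finset α} (f : α → ℕ)
    (hcard : G.card = H.card) (hne : G ≠ H) (hsum : ∑ v ∈ H, f v ≤ ∑ v ∈ G, f v) :
    ∃ c ∈ G \ H, ∃ b ∈ H \ G, f b ≤ f c := by
  by_contra! hno
  have hsd : (H \ G).card = (G \ H).card := Finset.card_sdiff_comm hcard.symm
  have hnonempty : (G \ H).Nonempty :=
    Finset.sdiff_nonempty.2 fun h => hne (Finset.eq_of_subset_of_card_le h hcard.ge)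
  obtain ⟨c, hc, hmax⟩ := Finset.exists_max_image (G \ H) f hnonempty
  have hle : ∑ v ∈ G \ H, f v ≤ _ := Finset.sum_le_card_nsmul (G \ H) f (f c) hmax
  have hge : _ ≤ ∑ v ∈ H \ G, f v :=
    Finset.card_nsmul_le_sum (H \ G) f (f c + 1) fun b hb => hno c hc b hb
  have hGH := Finset.sum_inter_add_sum_sdiff G H f
  have hHG := Finset.sum_inter_add_sum_sdiff H G f
  have hpos := hnonempty.card_pos
  rw [Finset.inter_comm] at hHG
  rw [hsd, smul_eq_mul, mul_add, mul_one] at hge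
  rw [smul_eq_mul] at hle
  omega

end

/-- For a pure, balanced simplicial complex `Δ` with at least one facet,
there is a complex `Δ'` all of whose facets are irrelevant such that `Δ ∪ Δ'` is
shellable. -/
theorem balanced_shellable_up_to_irrelevant
    {r : ℕ} (hr : 1 ≤ r) {n : Fin r → ℕ}
    (Δ : Finset (Vtx r n) → Prop) (hΔ : IsComplex Δ) (hpure : IsPure Δ)
    (hbal : ∀ F : Finset (Vtx r n), IsFacet Δ F → BalancedFace F)
    (hne : ∃ F : Finset (Vtx r n), IsFacet Δ F) :
    ∃ Δ' : Finset (Vtx r n) → Prop, IsComplex Δ' ∧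
      (∀ F : Finset (Vtx r n), IsFacet Δ' F → ¬ Relevant F) ∧
      Shellable (fun σ => Δ σ ∨ Δ' σ) := by
  classical
  have hle : ∀ σ, Δ σ → ∃ F, Δ F ∧ F.card = r ∧ σ ⊆ F := fun σ hσ =>
    let ⟨F, hF, hσF⟩ := exists_isFacet_superset hσ
    ⟨F, hF.1, (hbal F hF).card_eq, hσF⟩
  let Δ' : Finset (Vtx r n) → Prop := fun σ => ∃ τ, σ ⊆ τ ∧ τ.card = r ∧ ¬ Relevant τ
  have hface : ∀ σ, Δ σ ∨ Δ' σ → ∃ τ, (Δ τ ∨ Δ' τ) ∧ τ.card = r ∧ σ ⊆ τ := by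
    rintro σ (hσ | ⟨τ, hστ, hτ, hirr⟩)
    · obtain ⟨F, hF, hFr, hσF⟩ := hle σ hσ
      exact ⟨F, Or.inl hF, hFr, hσF⟩
    · exact ⟨τ, Or.inr ⟨τ, subset_rfl, hτ, hirr⟩, hτ, hστ⟩
  have hcard : ∀ F, IsFacet (fun σ => Δ σ ∨ Δ' σ) F → F.card = r := by
    intro F hF
    obtain ⟨τ, hτ, hτr, hFτ⟩ := hface F hF.1
    rw [hF.2 τ hτ hFτ, hτr]
  have hfacet : ∀ F, Δ F ∨ Δ' F → F.card = r → IsFacet (fun σ => Δ σ ∨ Δ' σ) F := by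
    refine fun F hF hFr => ⟨hF, fun G hG hFG => Finset.eq_of_subset_of_card_le hFG ?_⟩
    obtain ⟨τ, -, hτr, hGτ⟩ := hface G hG
    exact (Finset.card_le_card hGτ).trans (hτr.trans hFr.symm).le
  obtain ⟨Z, hZΔ⟩ := hne
  have hZ := hbal Z hZΔ
  have hexch : ∀ (G : Finset (Vtx r n)) (b c : Vtx r n), G.card = r → c ∈ G → b ∉ G → ¬ Relevant (insert b (G.erase c)) →
      IsFacet (fun σ => Δ σ ∨ Δ' σ) (insert b (G.erase c)) := by
    intro G b c hG hc hb hirr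
    have hr' : (insert b (G.erase c)).card = r := by
      rw [Finset.card_insert_of_notMem (fun h => hb (Finset.mem_of_mem_erase h)),
        Finset.card_erase_add_one hc, hG]
    exact hfacet _ (Or.inr ⟨_, subset_rfl, hr', hirr⟩) hr'
  refine ⟨Δ', ?_, ?_, fun F G hF hG => (hcard F hF).trans (hcard G hG).symm,
    exists_isShelling_of_key _ (facetKey Z) ?_⟩
  · rintro σ τ hτσ ⟨ρ, hσρ, hρ⟩
    exact ⟨ρ, hτσ.trans hσρ, hρ⟩
  · rintro F ⟨⟨τ, hFτ, hτ, hirr⟩, hmax⟩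
    rwa [hmax τ ⟨τ, subset_rfl, hτ, hirr⟩ hFτ]
  · intro G H hG hH hne hkey
    have hGr := hcard G hG
    have hHr := hcard H hH
    by_cases hex : ∃ c ∈ G, c ∉ H ∧ c ∉ Z
    · obtain ⟨c, hcG, hcH, hcZ⟩ := hex
      refine ⟨c, hcG, hcH, ?_⟩
      rcases exists_exchange_or_erase_subset hZ hGr hcG hcZ with ⟨z, hzZ, hzG, hirr⟩ | hsub
      · exact ⟨_, hexch G z c hGr hcG hzG hirr, facetKey_exchange_lt_of_notMem hcG hcZ hzZ,
          Finset.subset_insert _ _⟩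
      · refine ⟨Z, hfacet Z (Or.inl hZΔ.1) hZ.card_eq, ?_, hsub⟩
        refine Prod.Lex.toLex_lt_toLex.2 (Or.inl (Finset.card_lt_card ?_))
        rw [Finset.sdiff_self, Finset.empty_ssubset]
        exact ⟨c, Finset.mem_sdiff.2 ⟨hcG, hcZ⟩⟩
    · push Not at hex
      have hsub : G \ Z ⊆ H \ Z := fun v hv => by
        rw [Finset.mem_sdiff] at hv ⊢
        exact ⟨by_contra fun hvH => hv.2 (hex v hv.1 hvH), hv.2⟩
      have hkey' := Prod.Lex.toLex_le_toLex.1 hkey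
      have hsd : G \ Z = H \ Z := by
        refine Finset.eq_of_subset_of_card_le hsub ?_
        rcases hkey' with h | h
        · exact h.le
        · exact h.1.le
      have hsum : ∑ v ∈ H, vertexCost (G \ Z) v ≤ ∑ v ∈ G, vertexCost (G \ Z) v := by
        rcases hkey' with h | h
        · exact absurd h (by simp [hsd])
        · simpa [hsd] using h.2
      obtain ⟨c, hc, b, hb, hbc⟩ :=
        exists_weight_le_of_sum_le _ (hGr.trans hHr.symm) hne hsum
      rw [Finset.mem_sdiff] at hc hb
      have hcZ : c ∈ Z := hex c hc.1 hc.2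
      have hbZ : b ∈ Z := by_contra fun h =>
        hb.2 (Finset.mem_sdiff.1 (hsd ▸ Finset.mem_sdiff.2 ⟨hb.1, h⟩ : b ∈ G \ Z)).1
      have hlt := lt_of_le_of_ne hbc fun h =>
        hb.2 (hZ.injOn hbZ hcZ (fst_eq_of_vertexCost_eq h) ▸ hc.1)
      exact ⟨c, hc.1, hc.2, _, hexch G b c hGr hc.1 hb.2
        (not_relevant_exchange hZ hGr hc.1 hcZ hb.2 hbZ hlt),
        facetKey_exchange_lt_of_mem hc.1 hcZ hb.2 hbZ hlt, Finset.subset_insert _ _⟩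

end
end

section
/- Suppose n_i ≥ 1 for every i = 1, …, r. Let R ⊆ X be any balanced set, i.e., R contains exactly one vertex from each component. Then the simplicial complex on X generated by R together with all facets of the irrelevant complex Δ_irr(n) (that is, Δ_irr(n) ∪ ⟨R⟩) is shellable. -/
noncomputable section

open Finset

section NearInjective

variable {α ι : Type} [DecidableEq ι] {f : α → ι}

/-- A set of `card ι` elements meeting all fibres of `f` but one. -/
def NearTransversal [Fintype ι] (f : α → ι) (F : Finset α) : Prop :=
  F.card = Fintype.card ι ∧ (F.image f).card + 1 = Fintype.card ι

lemma NearTransversal.card_image [Fintype ι] {F : Finset α} (hF : NearTransversal f F) :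
    (F.image f).card + 1 = F.card := hF.2.trans hF.1.symm

variable [DecidableEq α]

/-- Deleting one of two elements with the same image does not change the image. -/
lemma image_erase_of_collision {F : Finset α} {v w : α} (hw : w ∈ F) (hvw : v ≠ w)
    (hf : f v = f w) : (F.erase v).image f = F.image f := by
  ext i
  simp only [mem_image, mem_erase]
  constructor
  · rintro ⟨a, ⟨-, ha⟩, rfl⟩
    exact ⟨a, ha, rfl⟩
  · rintro ⟨a, ha, rfl⟩
    by_cases hav : a = v
    · exact ⟨w, ⟨hvw.symm, hw⟩, by rw [hav, hf]⟩
    · exact ⟨a, ⟨hav, ha⟩, rfl⟩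

/-- If the image loses exactly one element, deleting either element of a colliding pair
makes the map injective. -/
lemma injOn_erase_of_collision {F : Finset α} {v w : α} (hF : (F.image f).card + 1 = F.card)
    (hv : v ∈ F) (hw : w ∈ F) (hvw : v ≠ w) (hf : f v = f w) :
    Set.InjOn f (F.erase v : Finset α) := by
  apply injOn_of_card_image_eq
  rw [image_erase_of_collision hw hvw hf, card_erase_of_mem hv]
  omega

lemma exists_collision {F : Finset α} (hF : (F.image f).card + 1 = F.card) :
    ∃ v ∈ F, ∃ w ∈ F, v ≠ w ∧ f v = f w := by
  by_contra! h
  have : Set.InjOn f (F : Set α) := fun a ha b hb hab => by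
    by_contra hne
    exact h a ha b hb hne hab
  have := card_image_of_injOn this
  omega

/-- Two colliding pairs coincide if the image loses exactly one element. -/
lemma collision_unique {F : Finset α} (hF : (F.image f).card + 1 = F.card) {v w a b : α}
    (hv : v ∈ F) (hw : w ∈ F) (hvw : v ≠ w) (hf : f v = f w)
    (ha : a ∈ F) (hb : b ∈ F) (hab : a ≠ b) (hfab : f a = f b) :
    (a = v ∧ b = w) ∨ (a = w ∧ b = v) := by
  have h₁ := injOn_erase_of_collision hF hv hw hvw hf
  have h₂ := injOn_erase_of_collision hF hw hv hvw.symm hf.symm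
  have h₁' : a = v ∨ b = v := by
    by_contra! h
    exact hab (h₁ (by simp [h.1, ha]) (by simp [h.2, hb]) hfab)
  have h₂' : a = w ∨ b = w := by
    by_contra! h
    exact hab (h₂ (by simp [h.1, ha]) (by simp [h.2, hb]) hfab)
  grind

variable [Fintype ι]

/-- A vertex outside the transversal `R` can be exchanged for a vertex of `R`. -/
lemma NearTransversal.exists_exchange_transversal {F R : Finset α} (hF : NearTransversal f F)
    (hR : ∀ i, ∃ y ∈ R, f y = i) {v : α} (hv : v ∈ F) (hvR : v ∉ R) :
    F.erase v ⊆ R ∨ ∃ y ∈ R, y ∉ F ∧ NearTransversal f (insert y (F.erase v)) := by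
  have swap : ∀ y ∈ R, y ∉ F → (insert y (F.erase v)).image f = F.image f →
      NearTransversal f (insert y (F.erase v)) := by
    intro y _ hyF him
    refine ⟨?_, by rw [him]; exact hF.2⟩
    rw [card_insert_of_notMem (by simp [hyF]), card_erase_of_mem hv]
    have := hF.1
    have := card_pos.mpr ⟨v, hv⟩
    omega
  by_cases hcol : ∃ w ∈ F, v ≠ w ∧ f v = f w
  · obtain ⟨w, hw, hvw, hf⟩ := hcol
    have him := image_erase_of_collision hw hvw hf
    by_cases hy : ∃ y ∈ R, y ∉ F ∧ f y ∈ F.image f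
    · obtain ⟨y, hyR, hyF, hy⟩ := hy
      refine Or.inr ⟨y, hyR, hyF, swap y hyR hyF ?_⟩
      rw [image_insert, him, insert_eq_of_mem hy]
    · push Not at hy
      left
      intro a ha
      obtain ⟨y, hyR, hya⟩ := hR (f a)
      have haF := mem_of_mem_erase ha
      have hyF : y ∈ F := by
        by_contra hyF
        exact hy y hyR hyF (hya ▸ mem_image_of_mem f haF)
      have hyv : y ≠ v := fun h => hvR (h ▸ hyR)
      have := injOn_erase_of_collision hF.card_image hv hw hvw hf
        (mem_coe.mpr ha) (mem_coe.mpr (mem_erase.mpr ⟨hyv, hyF⟩)) hya.symm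
      exact this ▸ hyR
  · push Not at hcol
    obtain ⟨y, hyR, hyv⟩ := hR (f v)
    have hyF : y ∉ F := fun hyF => hcol y hyF (fun h => hvR (h ▸ hyR)) hyv.symm
    refine Or.inr ⟨y, hyR, hyF, swap y hyR hyF ?_⟩
    rw [image_insert, hyv, ← image_insert, insert_erase hv]

/-- The exchange property among near transversals agreeing outside a transversal `R`. -/
lemma NearTransversal.exists_exchange {F G R : Finset α} (hF : NearTransversal f F)
    (hG : NearTransversal f G) (hR : Set.InjOn f (R : Set α)) (hFG : F \ R = G \ R)
    {x : α} (hxF : x ∈ F) (hxG : x ∉ G) :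
    ∃ y ∈ G, y ∉ F ∧ NearTransversal f (insert y (F.erase x)) := by
  have hmem : ∀ a, a ∉ R → (a ∈ F ↔ a ∈ G) := fun a ha => by
    simpa [ha] using congrArg (a ∈ ·) hFG
  have hxR : x ∈ R := by
    by_contra h
    exact hxG ((hmem x h).mp hxF)
  have hcard : ∀ y, y ∉ F → (insert y (F.erase x)).card = Fintype.card ι := by
    intro y hyF
    rw [card_insert_of_notMem (by simp [hyF]), card_erase_of_mem hxF]
    have := hF.1
    have := card_pos.mpr ⟨x, hxF⟩
    omega
  by_cases hcol : ∃ w ∈ F, x ≠ w ∧ f x = f w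
  · obtain ⟨w, hw, hxw, hf⟩ := hcol
    have him := image_erase_of_collision hw hxw hf
    have hinj := injOn_erase_of_collision hF.card_image hxF hw hxw hf
    obtain ⟨a, ha, b, hb, hab, hfab⟩ := exists_collision hG.card_image
    have key : ∀ a ∈ G, ∀ b ∈ G, f a = f b → a ∉ F → b ∉ R →
        ∃ y ∈ G, y ∉ F ∧ NearTransversal f (insert y (F.erase x)) := by
      intro a ha b hb hfab haF hbR
      refine ⟨a, ha, haF, hcard a haF, ?_⟩
      have hbF : b ∈ F := (hmem b hbR).mpr hb
      rw [image_insert, him, insert_eq_of_mem (hfab ▸ mem_image_of_mem f hbF)]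
      exact hF.2
    have hax : a ≠ x := fun h => hxG (h ▸ ha)
    have hbx : b ≠ x := fun h => hxG (h ▸ hb)
    by_cases haF : a ∈ F
    · have hbF : b ∉ F := fun hbF => hab (hinj (by simp [hax, haF]) (by simp [hbx, hbF]) hfab)
      have hbR : b ∈ R := by
        by_contra h
        exact hbF ((hmem b h).mpr hb)
      exact key b hb a ha hfab.symm hbF fun haR => hab (hR haR hbR hfab)
    · have haR : a ∈ R := by
        by_contra h
        exact haF ((hmem a h).mpr ha)
      exact key a ha b hb hfab haF fun hbR => hab (hR haR hbR hfab)
  · push Not at hcol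
    have hxG' : f x ∉ G.image f := by
      intro h
      obtain ⟨g, hg, hgx⟩ := mem_image.mp h
      have hne : x ≠ g := fun h => hxG (h ▸ hg)
      by_cases hgR : g ∈ R
      · exact hne (hR hxR hgR hgx.symm)
      · exact hcol g ((hmem g hgR).mpr hg) hne hgx.symm
    have hsub : ¬ G.image f ⊆ (F.image f).erase (f x) := by
      intro h
      have := card_le_card h
      rw [card_erase_of_mem (mem_image_of_mem f hxF)] at this
      have := hF.2
      have := hG.2
      have := card_pos.mpr ⟨_, mem_image_of_mem f hxF⟩
      omega
    obtain ⟨j, hjG, hj⟩ := not_subset.mp hsub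
    obtain ⟨y, hyG, rfl⟩ := mem_image.mp hjG
    have hyx : f y ≠ f x := fun h => hxG' (h ▸ hjG)
    have hyF : f y ∉ F.image f := fun h => hj (mem_erase.mpr ⟨hyx, h⟩)
    have hyF' : y ∉ F := fun h => hyF (mem_image_of_mem f h)
    refine ⟨y, hyG, hyF', hcard y hyF', ?_⟩
    have him : (F.erase x).image f = (F.image f).erase (f x) := by
      ext i
      simp only [mem_image, mem_erase]
      constructor
      · rintro ⟨a, ⟨hax, ha⟩, rfl⟩
        exact ⟨fun h => hcol a ha hax.symm h.symm, a, ha, rfl⟩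
      · rintro ⟨hi, a, ha, rfl⟩
        exact ⟨a, ⟨fun h => hi (h ▸ rfl), ha⟩, rfl⟩
    rw [image_insert, him, card_insert_of_notMem hj,
      card_erase_of_mem (mem_image_of_mem f hxF)]
    have := hF.2
    have := card_pos.mpr ⟨_, mem_image_of_mem f hxF⟩
    omega

end NearInjective

/-- A complex whose facets all have the same size is shellable as soon as its facets can be
ordered by an injective key so that the shelling condition holds. -/
lemma shellable_of_key {α β : Type} [DecidableEq α] [LinearOrder β] {Δ : Finset α → Prop}
    {S : Finset (Finset α)} {c : ℕ} (hS : ∀ F, IsFacet Δ F ↔ F ∈ S) (hc : ∀ F ∈ S, F.card = c)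
    {key : Finset α → β} (hkey : Function.Injective key)
    (h : ∀ F ∈ S, ∀ G ∈ S, key G < key F →
      ∃ v ∈ F, v ∉ G ∧ ∃ H ∈ S, key H < key F ∧ F.erase v ⊆ H) : Shellable Δ := by
  refine ⟨fun F G hF hG => (hc F ((hS F).mp hF)).trans (hc G ((hS G).mp hG)).symm, ?_⟩
  let e := (S.image key).orderIsoOfFin rfl
  have hex : ∀ i, ∃ F ∈ S, key F = e i := fun i => mem_image.mp (e i).2
  choose E hES hEkey using hex
  have hlt : ∀ i j, key (E i) < key (E j) ↔ i < j := fun i j => by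
    rw [hEkey, hEkey, Subtype.coe_lt_coe, e.lt_iff_lt]
  have hsurj : ∀ G ∈ S, ∃ i, E i = G := by
    intro G hG
    refine ⟨e.symm ⟨key G, mem_image_of_mem key hG⟩, hkey ?_⟩
    rw [hEkey, e.apply_symm_apply]
  refine ⟨_, E, ?_, fun i => (hS _).mpr (hES i), fun G hG => hsurj G ((hS G).mp hG), ?_⟩
  · intro i j hij
    apply e.injective
    apply Subtype.ext
    rw [← hEkey, ← hEkey, hij]
  · rintro i - σ hσ ⟨k, hki, hσk⟩
    obtain ⟨v, hv, hvG, H, hHS, hH, hsub⟩ := h _ (hES i) _ (hES k) ((hlt k i).mpr hki)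
    obtain ⟨l, rfl⟩ := hsurj H hHS
    exact ⟨(E i).erase v, subset_erase.mpr ⟨hσ, fun hvσ => hvG (hσk hvσ)⟩, erase_subset _ _,
      card_erase_add_one hv, l, (hlt l i).mp hH, hsub⟩

lemma isIrrFacet_iff_nearTransversal {r : ℕ} {n : Fin r → ℕ} (τ : Finset (Vtx r n)) :
    IsIrrFacet τ ↔ NearTransversal Sigma.fst τ := by
  simp only [IsIrrFacet, NearTransversal, Fintype.card_fin]
  refine and_congr_right fun hτ => ⟨?_, fun h => ?_⟩
  · rintro ⟨v, w, hv, hw, hvw, hf, huniq⟩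
    have hinj : Set.InjOn Sigma.fst (τ.erase v : Set (Vtx r n)) := by
      intro a ha b hb hab
      have ha := mem_erase.mp (mem_coe.mp ha)
      have hb := mem_erase.mp (mem_coe.mp hb)
      by_contra hne
      rcases huniq a b ha.2 hb.2 hne hab with h | h
      · exact ha.1 h.1
      · exact hb.1 h.2
    rw [← image_erase_of_collision hw hvw hf, card_image_of_injOn hinj, card_erase_add_one hv, hτ]
  · have h' : (τ.image Sigma.fst).card + 1 = τ.card := h.trans hτ.symm
    obtain ⟨v, hv, w, hw, hvw, hf⟩ := exists_collision h'
    exact ⟨v, w, hv, hw, hvw, hf, fun a b ha hb hab hfab =>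
      collision_unique h' hv hw hvw hf ha hb hab hfab⟩

/-- The facets of a complex generated by sets of the same size are the generators. -/
lemma isFacet_iff_of_generators {α : Type} {Δ P : Finset α → Prop} {c : ℕ}
    (hΔ : ∀ σ, Δ σ ↔ ∃ τ, P τ ∧ σ ⊆ τ) (hc : ∀ τ, P τ → τ.card = c) (F : Finset α) :
    IsFacet Δ F ↔ P F := by
  constructor
  · rintro ⟨hF, hmax⟩
    obtain ⟨τ, hτ, hsub⟩ := (hΔ F).mp hF
    rwa [hmax τ ((hΔ τ).mpr ⟨τ, hτ, Subset.rfl⟩) hsub]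
  · refine fun hF => ⟨(hΔ F).mpr ⟨F, hF, Subset.rfl⟩, fun G hG hFG => ?_⟩
    obtain ⟨τ, hτ, hsub⟩ := (hΔ G).mp hG
    have : F = τ := eq_of_subset_of_card_le (hFG.trans hsub) (by rw [hc F hF, hc τ hτ])
    exact Subset.antisymm hFG (this ▸ hsub)

/-- Near transversals together with a transversal `R` satisfy the shelling condition for the
order by number of elements outside `R`, refined by the colexicographic order. -/
lemma nearTransversal_shelling_condition {α ι : Type} [LinearOrder α] [DecidableEq ι]
    [Fintype ι] {f : α → ι} {R : Finset α} (hRs : ∀ i, ∃ y ∈ R, f y = i)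
    (hRi : Set.InjOn f (R : Set α)) (hRc : R.card = Fintype.card ι) {F G : Finset α}
    (hF : F = R ∨ NearTransversal f F) (hG : G = R ∨ NearTransversal f G)
    (hlt : toLex ((G \ R).card, toColex G) < toLex ((F \ R).card, toColex F)) :
    ∃ v ∈ F, v ∉ G ∧ ∃ H, (H = R ∨ NearTransversal f H) ∧
      toLex ((H \ R).card, toColex H) < toLex ((F \ R).card, toColex F) ∧ F.erase v ⊆ H := by
  by_cases hsub : F \ R ⊆ G
  · have hsub' : F \ R ⊆ G \ R := fun a ha =>
      mem_sdiff.mpr ⟨hsub ha, (mem_sdiff.mp ha).2⟩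
    obtain ⟨hle, hcolex⟩ : (G \ R).card ≤ (F \ R).card ∧ toColex G < toColex F := by
      have := card_le_card hsub'
      rcases Prod.Lex.toLex_lt_toLex.mp hlt with h | h
      · exact absurd h (by simpa using this)
      · exact ⟨h.1.le, h.2⟩
    have hFG : F \ R = G \ R := eq_of_subset_of_card_le hsub' hle
    have hFR_GR : F = R ↔ G = R := by
      have hcard : ∀ K : Finset α, (K = R ∨ NearTransversal f K) → (K = R ↔ K \ R = ∅) := by
        intro K hK
        have hKc : K.card = R.card := by
          rcases hK with rfl | hK
          · rfl
          · rw [hK.1, hRc]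
        rw [sdiff_eq_empty_iff_subset]
        exact ⟨fun h => h.subset, fun h => eq_of_subset_of_card_le h hKc.ge⟩
      rw [hcard F hF, hcard G hG, hFG]
    have hFR : F ≠ R := fun h => hcolex.ne (by rw [h, hFR_GR.mp h])
    obtain ⟨x, hxF, hxG, hx⟩ := Colex.toColex_lt_toColex_iff_exists_forall_lt.mp hcolex
    have hxR : x ∈ R := by
      by_contra h
      exact hxG (hsub (mem_sdiff.mpr ⟨hxF, h⟩))
    obtain ⟨y, hyG, hyF, hH⟩ := (hF.resolve_left hFR).exists_exchange
      (hG.resolve_left (hFR_GR.not.mp hFR)) hRi hFG hxF hxG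
    have hyR : y ∈ R := by
      by_contra h
      exact hyF (mem_sdiff.mp (hFG ▸ mem_sdiff.mpr ⟨hyG, h⟩)).1
    refine ⟨x, hxF, hxG, _, Or.inr hH, Prod.Lex.toLex_lt_toLex.mpr (Or.inr ⟨?_, ?_⟩),
      subset_insert _ _⟩
    · simp only
      rw [insert_sdiff_of_mem _ hyR, erase_sdiff_comm, erase_eq_of_notMem (by simp [hxR])]
    · refine Colex.toColex_lt_toColex_iff_exists_forall_lt.mpr ⟨x, hxF, ?_, fun b hb hbF => ?_⟩
      · simpa using fun h : x = y => hyF (h ▸ hxF)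
      · rcases mem_insert.mp hb with rfl | hb
        · exact hx b hyG hyF
        · exact absurd (mem_of_mem_erase hb) hbF
  · obtain ⟨v, hv, hvG⟩ := not_subset.mp hsub
    obtain ⟨hvF, hvR⟩ := mem_sdiff.mp hv
    have hF' : NearTransversal f F := hF.resolve_left fun h => hvR (h ▸ hvF)
    refine ⟨v, hvF, hvG, ?_⟩
    rcases hF'.exists_exchange_transversal hRs hvF hvR with h | ⟨y, hyR, hyF, hH⟩
    · refine ⟨R, Or.inl rfl, Prod.Lex.toLex_lt_toLex.mpr (Or.inl ?_), h⟩
      simpa using card_pos.mpr ⟨v, hv⟩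
    · refine ⟨_, Or.inr hH, Prod.Lex.toLex_lt_toLex.mpr (Or.inl ?_), subset_insert _ _⟩
      rw [insert_sdiff_of_mem _ hyR, erase_sdiff_comm]
      exact card_erase_lt_of_mem hv

/-- A complex whose facets are the near transversals together with a transversal `R` is
shellable. -/
lemma shellable_of_isFacet_iff_nearTransversal {α ι : Type} [LinearOrder α] [Fintype α]
    [DecidableEq ι] [Fintype ι] {f : α → ι} {R : Finset α} (hRs : ∀ i, ∃ y ∈ R, f y = i)
    (hRi : Set.InjOn f (R : Set α)) (hRc : R.card = Fintype.card ι) {Δ : Finset α → Prop}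
    (hΔ : ∀ F, IsFacet Δ F ↔ F = R ∨ NearTransversal f F) : Shellable Δ := by
  classical
  refine shellable_of_key (S := {F | F = R ∨ NearTransversal f F}) (c := Fintype.card ι)
    (key := fun F => toLex ((F \ R).card, toColex F)) (by simpa using hΔ) ?_ ?_ ?_
  · intro F hF
    rcases (mem_filter.mp hF).2 with rfl | hF
    exacts [hRc, hF.1]
  · intro F G h
    simpa using congrArg (fun p => (ofLex p).2) h
  · intro F hF G hG hlt
    simp only [mem_filter_univ] at hF hG ⊢
    exact nearTransversal_shelling_condition hRs hRi hRc hF hG hlt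

/-- If every `n_i ≥ 1` and `R` is a balanced set, then the complex
generated by `R` together with all facets of the irrelevant complex `Δ_irr(n)` is
shellable. -/
theorem irrComplex_union_balanced_facet_shellable
    {r : ℕ} (hr : 1 ≤ r) {n : Fin r → ℕ} (hn : ∀ i : Fin r, 1 ≤ n i)
    (R : Finset (Vtx r n)) (hR : BalancedFace R) :
    Shellable (fun σ : Finset (Vtx r n) => σ ⊆ R ∨ irrComplex r n σ) := by
  have hRs : ∀ i, ∃ y ∈ R, y.1 = i := fun i => by
    obtain ⟨j, hj, -⟩ := hR i
    exact ⟨⟨i, j⟩, hj, rfl⟩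
  have hRi : Set.InjOn Sigma.fst (R : Set (Vtx r n)) := by
    rintro ⟨i, a⟩ ha ⟨j, b⟩ hb hab
    obtain rfl : i = j := hab
    rw [(hR i).unique ha hb]
  have hRc : R.card = Fintype.card (Fin r) := by
    rw [← card_image_of_injOn hRi, ← card_univ]
    congr 1
    ext i
    simpa using hRs i
  let _ : LinearOrder (Vtx r n) := LinearOrder.lift' (Fintype.equivFin _) (Equiv.injective _)
  refine shellable_of_isFacet_iff_nearTransversal hRs hRi hRc
    (isFacet_iff_of_generators (c := r) (fun σ => ?_) ?_)
  · simp only [irrComplex, isIrrFacet_iff_nearTransversal]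
    grind
  · rintro F (rfl | hF)
    exacts [hRc.trans (Fintype.card_fin r), hF.1.trans (Fintype.card_fin r)]

end
end

section
/- Let r = 2 and n = (2,2), and write the vertices of the first component of X as a, b, c and those of the second component as d, e, f. Let Δ be the pure three-dimensional simplicial complex on X generated by the two facets {a,d,e,f} and {b,c,d,e}. Then Δ is not gallery-connected; moreover, no pure simplicial complex Δ'' on X that differs from Δ only by irrelevant faces (i.e., such that every face in the symmetric difference of Δ and Δ'' is irrelevant) is gallery-connected. -/
noncomputable section

/-- The six vertices of `X` for `P² × P²`: `a, b, c` in the first component and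
`d, e, f` in the second. -/
def vA : Vtx 2 (fun _ => 2) := ⟨0, 0⟩
def vB : Vtx 2 (fun _ => 2) := ⟨0, 1⟩
def vC : Vtx 2 (fun _ => 2) := ⟨0, 2⟩
def vD : Vtx 2 (fun _ => 2) := ⟨1, 0⟩
def vE : Vtx 2 (fun _ => 2) := ⟨1, 1⟩
def vF : Vtx 2 (fun _ => 2) := ⟨1, 2⟩

/-- The simplicial complex generated by the facets `{a,d,e,f}` and `{b,c,d,e}`:
two tetrahedra glued along an edge. -/
def twoTetrahedra : Finset (Vtx 2 (fun _ => 2)) → Prop := fun σ =>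
  σ ⊆ ({vA, vD, vE, vF} : Finset (Vtx 2 (fun _ => 2))) ∨
  σ ⊆ ({vB, vC, vD, vE} : Finset (Vtx 2 (fun _ => 2)))

/-- A complex with exactly two facets, which do not meet in codimension 1, is not
gallery-connected. -/
theorem not_galleryConnected_of_two_facets {α : Type} [DecidableEq α] {Δ : Finset α → Prop}
    {S T : Finset α} (hS : IsFacet Δ S) (hT : IsFacet Δ T) (hne : S ≠ T)
    (hcard : (S ∩ T).card + 1 ≠ S.card) (h : ∀ F, IsFacet Δ F → F = S ∨ F = T) :
    ¬ GalleryConnected Δ := by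
  intro hΔ
  obtain ⟨m, g, h0, hm, hg, hstep⟩ := hΔ S T hS hT
  have hconst : ∀ i ≤ m, g i = S := by
    intro i
    induction i with
    | zero => exact fun _ => h0
    | succ k ih =>
      intro hk
      have hgk := ih (by omega)
      have hk' := hstep k (by omega)
      rcases h _ (hg (k + 1) hk) with h' | h'
      · exact h'
      · rw [hgk, h'] at hk'
        exact absurd hk' hcard
  exact hne ((hconst m le_rfl).symm.trans hm)

/-- In `P² × P²`, a set of four vertices meets both components. -/
theorem relevant_of_card_eq_four {σ : Finset (Vtx 2 (fun _ => 2))} (hσ : σ.card = 4) :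
    Relevant σ := by
  intro i
  by_contra! hi
  have hsub : σ ⊆ Finset.univ.filter (fun v => v.1 ≠ i) := fun v hv => by simpa using hi v hv
  have hle := Finset.card_le_card hsub
  have hcard : ∀ i : Fin 2,
      (Finset.univ.filter (fun v : Vtx 2 (fun _ => 2) => v.1 ≠ i)).card = 3 := by decide
  rw [hcard] at hle
  omega

theorem Relevant.mono {r : ℕ} {n : Fin r → ℕ} {σ τ : Finset (Vtx r n)} (hσ : Relevant σ)
    (h : σ ⊆ τ) : Relevant τ := fun i =>
  let ⟨v, hv, hi⟩ := hσ i
  ⟨v, h hv, hi⟩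

theorem card_le_four_of_twoTetrahedra {σ : Finset (Vtx 2 (fun _ => 2))} (hσ : twoTetrahedra σ) :
    σ.card ≤ 4 := by
  rcases hσ with h | h <;> exact (Finset.card_le_card h).trans (by decide)

/-- A four-element face of the two-tetrahedra complex is a facet of every complex with the
same relevant faces. -/
theorem isFacet_of_card_eq_four {Δ : Finset (Vtx 2 (fun _ => 2)) → Prop}
    (hΔ : ∀ σ, Relevant σ → (twoTetrahedra σ ↔ Δ σ)) {S : Finset (Vtx 2 (fun _ => 2))}
    (hS : twoTetrahedra S) (hcard : S.card = 4) : IsFacet Δ S := by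
  have hrel := relevant_of_card_eq_four hcard
  refine ⟨(hΔ S hrel).1 hS, fun G hG hSG => Finset.eq_of_subset_of_card_le hSG ?_⟩
  rw [hcard]
  exact card_le_four_of_twoTetrahedra ((hΔ G (hrel.mono hSG)).2 hG)

theorem not_galleryConnected_of_relevant_iff {Δ : Finset (Vtx 2 (fun _ => 2)) → Prop}
    (hpure : IsPure Δ) (hΔ : ∀ σ, Relevant σ → (twoTetrahedra σ ↔ Δ σ)) :
    ¬ GalleryConnected Δ := by
  have hS : IsFacet Δ {vA, vD, vE, vF} :=
    isFacet_of_card_eq_four hΔ (Or.inl subset_rfl) (by decide)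
  have hT : IsFacet Δ {vB, vC, vD, vE} :=
    isFacet_of_card_eq_four hΔ (Or.inr subset_rfl) (by decide)
  refine not_galleryConnected_of_two_facets hS hT (by decide) (by decide) fun F hF => ?_
  have hcard : F.card = 4 := (hpure F _ hF hS).trans (by decide)
  refine ((hΔ F (relevant_of_card_eq_four hcard)).2 hF.1).imp (fun h => ?_) (fun h => ?_) <;>
  · refine Finset.eq_of_subset_of_card_le h ?_
    rw [hcard]
    decide

theorem isPure_twoTetrahedra : IsPure twoTetrahedra := by
  have hfacet : ∀ F, IsFacet twoTetrahedra F → F.card = 4 := by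
    rintro F ⟨h | h, hmax⟩
    · rw [hmax _ (Or.inl subset_rfl) h]
      decide
    · rw [hmax _ (Or.inr subset_rfl) h]
      decide
  exact fun F G hF hG => (hfacet F hF).trans (hfacet G hG).symm

/-- The two-tetrahedra complex is not gallery-connected, and neither is
any pure complex differing from it only by irrelevant faces. -/
theorem twoTetrahedra_not_gallery_connected :
    ¬ GalleryConnected twoTetrahedra ∧
      ∀ Δ'' : Finset (Vtx 2 (fun _ => 2)) → Prop, IsComplex Δ'' → IsPure Δ'' →
        (∀ σ : Finset (Vtx 2 (fun _ => 2)), ¬ (twoTetrahedra σ ↔ Δ'' σ) → ¬ Relevant σ) →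
        ¬ GalleryConnected Δ'' := by
  refine ⟨not_galleryConnected_of_relevant_iff isPure_twoTetrahedra fun _ _ => Iff.rfl,
    fun Δ'' _ hpure hΔ => not_galleryConnected_of_relevant_iff hpure fun σ hσ => ?_⟩
  by_contra h
  exact hΔ σ h hσ

end
end
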